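/- Let f : ℝ → ℝ³ be a C^∞ embedding of period L parametrized by arc length with curvature κ(s) = |f''(s)| > 0 for all s. Then 4π·Wr(f) = −2 ∫₀^L τ(s) ds + 4πk for some integer k; equivalently, Wr(f) + Tω(f) ∈ ℤ, where Wr is the writhe and Tω is the total torsion. -/

import Mathlib

noncomputable section
open Real

/-- Euclidean 3-space. -/
abbrev E3 : Type := EuclideanSpace ℝ (Fin 3)

/-- The dot product of two vectors in `E3`. -/
def dot3 (u v : E3) : ℝ := u 0 * v 0 + u 1 * v 1 + u 2 * v 2

/-- The cross product of two vectors in `E3`. -/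
def cross3 (u v : E3) : E3 :=
  (WithLp.equiv 2 (Fin 3 → ℝ)).symm
    ![u 1 * v 2 - u 2 * v 1, u 2 * v 0 - u 0 * v 2, u 0 * v 1 - u 1 * v 0]

/-- The determinant `det(u, v, w)` of three vectors in `E3`. -/
def det3 (u v w : E3) : ℝ := dot3 u (cross3 v w)

/-- The writhe of a closed curve `g` of period `L`, given by the Gauss integral. -/
def writhe (g : ℝ → E3) (L : ℝ) : ℝ :=
  (1 / (4 * π)) * ∫ s in (0:ℝ)..L, ∫ t in (0:ℝ)..L,
    det3 (deriv g s) (deriv g t) (g s - g t) / ‖g s - g t‖ ^ 3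

/-- The inversion in the sphere of center `P` and radius `r`. -/
def inv3 (P : E3) (r : ℝ) (x : E3) : E3 := P + (r ^ 2 / ‖x - P‖ ^ 2) • (x - P)

/-- The differential of the inversion `inv3 P r` at `x`, applied to `v`. -/
def dInv (P : E3) (r : ℝ) (x v : E3) : E3 :=
  (r ^ 2 / ‖x - P‖ ^ 2) • (v - ((2 * dot3 (x - P) v) / ‖x - P‖ ^ 2) • (x - P))

/-- The total twist of a closed curve `g` of period `L` with unit normal framing `w`. -/
def twist (g w : ℝ → E3) (L : ℝ) : ℝ :=
  (1 / (2 * π)) * ∫ s in (0:ℝ)..L,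
    dot3 (deriv w s) (cross3 ((‖deriv g s‖)⁻¹ • deriv g s) (w s))

/-- The principal normal `e₂ = f''/κ` of an arc-length parametrized curve. -/
def e2 (f : ℝ → E3) (s : ℝ) : E3 := (‖deriv (deriv f) s‖)⁻¹ • deriv (deriv f) s

/-- The binormal `e₃ = e₁ × e₂` of an arc-length parametrized curve. -/
def e3 (f : ℝ → E3) (s : ℝ) : E3 := cross3 (deriv f s) (e2 f s)

/-- The torsion `τ = e₂'·e₃` of an arc-length parametrized curve. -/
def torsionArc (f : ℝ → E3) (s : ℝ) : ℝ := dot3 (deriv (e2 f) s) (e3 f s)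

/-- The total torsion `Tω = (1/2π) ∫ τ` of an arc-length parametrized closed curve. -/
def totalTorsionArc (f : ℝ → E3) (L : ℝ) : ℝ :=
  (1 / (2 * π)) * ∫ s in (0:ℝ)..L, torsionArc f s

/-- The torsion `τ_g = det(g', g'', g''')/|g' × g''|²` of a regular curve. -/
def torsionGen (g : ℝ → E3) (s : ℝ) : ℝ :=
  det3 (deriv g s) (deriv (deriv g) s) (deriv (deriv (deriv g)) s) /
    ‖cross3 (deriv g s) (deriv (deriv g) s)‖ ^ 2

/-- The total torsion `Tω = (1/2π) ∫ τ_g |g'|` of a regular closed curve. -/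
def totalTorsionGen (g : ℝ → E3) (L : ℝ) : ℝ :=
  (1 / (2 * π)) * ∫ s in (0:ℝ)..L, torsionGen g s * ‖deriv g s‖

/-- The osculating circle at `s` of an arc-length parametrized curve with `κ(s) > 0`:
the circle of center `f(s) + (1/κ(s)) e₂(s)` and radius `1/κ(s)` in the plane through
`f(s)` spanned by `e₁(s)` and `e₂(s)`. -/
def osculatingCircleArc (f : ℝ → E3) (s : ℝ) : Set E3 :=
  {y | (∃ a b : ℝ, y = f s + a • deriv f s + b • e2 f s) ∧
    ‖y - (f s + (‖deriv (deriv f) s‖)⁻¹ • e2 f s)‖ = (‖deriv (deriv f) s‖)⁻¹}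

/-- The curvature tube of `f`: the union of all osculating circles. -/
def curvatureTube (f : ℝ → E3) : Set E3 := ⋃ s : ℝ, osculatingCircleArc f s

lemma det3_eq (u v w : E3) : det3 u v w =
    u 0 * (v 1 * w 2 - v 2 * w 1) + u 1 * (v 2 * w 0 - v 0 * w 2)
      + u 2 * (v 0 * w 1 - v 1 * w 0) := by
  simp [det3, dot3, cross3]

lemma norm_sq_eq_dot3 (v : E3) : ‖v‖ ^ 2 = dot3 v v := by
  rw [EuclideanSpace.norm_sq_eq, Fin.sum_univ_three]
  simp [dot3, sq]

lemma dot3_self_of_norm_eq_one {v : E3} (h : ‖v‖ = 1) : dot3 v v = 1 := by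
  rw [← norm_sq_eq_dot3, h]; norm_num

lemma dot3_smul_right (c : ℝ) (u v : E3) : dot3 u (c • v) = c * dot3 u v := by
  simp [dot3]; ring

lemma one_sub_dot3_pos {p v : E3} (hp : ‖p‖ = 1) (hv : ‖v‖ = 1) (h : v ≠ p) :
    0 < 1 - dot3 p v := by
  have h1 : ‖v - p‖ ^ 2 = 2 * (1 - dot3 p v) := by
    have hp' := dot3_self_of_norm_eq_one hp
    have hv' := dot3_self_of_norm_eq_one hv
    rw [norm_sq_eq_dot3]
    simp only [dot3, PiLp.sub_apply] at *
    linear_combination hp' + hv'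
  have h2 : 0 < ‖v - p‖ := norm_pos_iff.2 (sub_ne_zero.2 h)
  nlinarith [pow_pos h2 2]

section Calculus

variable {X : Type*} [NormedAddCommGroup X] [NormedSpace ℝ X]

lemma HasFDerivAt.euclidean_apply {u : X → E3} {u' : X →L[ℝ] E3} {x : X}
    (hu : HasFDerivAt u u' x) (i : Fin 3) :
    HasFDerivAt (fun y => u y i) ((EuclideanSpace.proj i : E3 →L[ℝ] ℝ).comp u') x :=
  (EuclideanSpace.proj i : E3 →L[ℝ] ℝ).hasFDerivAt.comp x hu

lemma HasDerivAt.euclidean_apply {u : ℝ → E3} {u' : E3} {x : ℝ}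
    (hu : HasDerivAt u u' x) (i : Fin 3) :
    HasDerivAt (fun y => u y i) (u' i) x :=
  (EuclideanSpace.proj i : E3 →L[ℝ] ℝ).hasFDerivAt.comp_hasDerivAt x hu

lemma hasFDerivAt_dot3_const {u : X → E3} {u' : X →L[ℝ] E3} {x : X}
    (hu : HasFDerivAt u u' x) (p : E3) :
    ∃ D : X →L[ℝ] ℝ, HasFDerivAt (fun y => dot3 p (u y)) D x ∧
      ∀ a, D a = dot3 p (u' a) := by
  refine ⟨_, (((hu.euclidean_apply 0).const_mul (p 0)).add
    ((hu.euclidean_apply 1).const_mul (p 1))).add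
    ((hu.euclidean_apply 2).const_mul (p 2)), fun a => ?_⟩
  simp [dot3]

lemma hasFDerivAt_det3_const {u v : X → E3} {u' v' : X →L[ℝ] E3} {x : X}
    (hu : HasFDerivAt u u' x) (hv : HasFDerivAt v v' x) (p : E3) :
    ∃ D : X →L[ℝ] ℝ, HasFDerivAt (fun y => det3 p (u y) (v y)) D x ∧
      ∀ a, D a = det3 p (u' a) (v x) + det3 p (u x) (v' a) := by
  simp only [det3_eq]
  have U := hu.euclidean_apply
  have W := hv.euclidean_apply
  refine ⟨_, (((((U 1).mul (W 2)).sub ((U 2).mul (W 1))).const_mul (p 0)).add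
    ((((U 2).mul (W 0)).sub ((U 0).mul (W 2))).const_mul (p 1))).add
    ((((U 0).mul (W 1)).sub ((U 1).mul (W 0))).const_mul (p 2)), fun a => ?_⟩
  simp
  ring

lemma hasDerivAt_dot3 {u v : ℝ → E3} {u' v' : E3} {x : ℝ}
    (hu : HasDerivAt u u' x) (hv : HasDerivAt v v' x) :
    HasDerivAt (fun y => dot3 (u y) (v y)) (dot3 u' (v x) + dot3 (u x) v') x := by
  have U := hu.euclidean_apply
  have W := hv.euclidean_apply
  refine ((((U 0).mul (W 0)).add ((U 1).mul (W 1))).add ((U 2).mul (W 2))).congr_deriv ?_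
  simp only [dot3]; ring

lemma hasDerivAt_det3_const {u v : ℝ → E3} {u' v' : E3} {x : ℝ}
    (hu : HasDerivAt u u' x) (hv : HasDerivAt v v' x) (p : E3) :
    HasDerivAt (fun y => det3 p (u y) (v y)) (det3 p u' (v x) + det3 p (u x) v') x := by
  obtain ⟨D, hD, h⟩ := hasFDerivAt_det3_const hu.hasFDerivAt hv.hasFDerivAt p
  exact hD.hasDerivAt.congr_deriv (by simp [h])

variable {Y : Type*} [TopologicalSpace Y]

lemma continuousAt_det3 {u v w : Y → E3} {y : Y} (hu : ContinuousAt u y)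
    (hv : ContinuousAt v y) (hw : ContinuousAt w y) :
    ContinuousAt (fun y => det3 (u y) (v y) (w y)) y := by
  simp only [det3_eq]; fun_prop

lemma continuous_dot3 {u v : Y → E3} (hu : Continuous u) (hv : Continuous v) :
    Continuous (fun y => dot3 (u y) (v y)) := by
  unfold dot3; fun_prop

lemma continuous_det3 {u v w : Y → E3} (hu : Continuous u)
    (hv : Continuous v) (hw : Continuous w) :
    Continuous (fun y => det3 (u y) (v y) (w y)) := by
  simp only [det3_eq]; fun_prop

end Calculus

/-- The winding number of a nowhere vanishing closed `C¹` loop in `ℂ` is an integer. -/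
lemma exists_int_integral_im_logDeriv {g g' : ℝ → ℂ} {L : ℝ}
    (hg : ∀ t, HasDerivAt g (g' t) t) (hg' : Continuous g') (h0 : ∀ t, g t ≠ 0)
    (hL : g L = g 0) :
    ∃ n : ℤ, ∫ t in (0:ℝ)..L, (g' t / g t).im = 2 * π * n := by
  have hgc : Continuous g := continuous_iff_continuousAt.2 fun t => (hg t).continuousAt
  have hc : Continuous fun t => g' t / g t := hg'.div hgc h0
  have hI : ∀ t, HasDerivAt (fun x => ∫ y in (0:ℝ)..x, g' y / g y) (g' t / g t) t := fun t =>
    hc.integral_hasStrictDerivAt 0 t |>.hasDerivAt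
  have hd : ∀ t, HasDerivAt (fun x => g x * Complex.exp (-∫ y in (0:ℝ)..x, g' y / g y)) 0 t := by
    intro t
    refine ((hg t).mul (hI t).neg.cexp).congr_deriv ?_
    field_simp [h0 t]
    ring
  have hconst := is_const_of_deriv_eq_zero (fun t => (hd t).differentiableAt)
    (fun t => (hd t).deriv) L 0
  simp only [intervalIntegral.integral_same, neg_zero, Complex.exp_zero, mul_one, hL] at hconst
  have hexp : Complex.exp (-∫ y in (0:ℝ)..L, g' y / g y) = 1 :=
    mul_left_cancel₀ (h0 0) (hconst.trans (mul_one _).symm)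
  rw [Complex.exp_neg, inv_eq_one, Complex.exp_eq_one_iff] at hexp
  obtain ⟨n, hn⟩ := hexp
  refine ⟨n, ?_⟩
  have him := Complex.imCLM.intervalIntegral_comp_comm (hc.intervalIntegrable (μ := MeasureTheory.volume) 0 L)
  simp only [Complex.imCLM_apply] at him
  rw [him, hn]
  simp
  ring

lemma im_div_eq (x y a b : ℝ) :
    ((⟨x, y⟩ : ℂ) / (⟨a, b⟩ : ℂ)).im = (y * a - x * b) / (a ^ 2 + b ^ 2) := by
  rw [Complex.div_im]
  simp only [Complex.normSq_mk]
  rw [← sub_div]; ring_nf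

/-- A potential, away from `p`, of the area form of the unit sphere. -/
def spherePotential (p v w : E3) : ℝ := det3 p v w / (1 - dot3 p v)

lemma hasDerivAt_complex_mk {x y : ℝ → ℝ} {x' y' t : ℝ} (hx : HasDerivAt x x' t)
    (hy : HasDerivAt y y' t) : HasDerivAt (fun t => (⟨x t, y t⟩ : ℂ)) ⟨x', y'⟩ t := by
  simp only [Complex.mk_eq_add_mul_I]
  exact hx.ofReal_comp.add (hy.ofReal_comp.mul_const _)

lemma continuous_complex_mk {x y : ℝ → ℝ} (hx : Continuous x) (hy : Continuous y) :
    Continuous (fun t => (⟨x t, y t⟩ : ℂ)) := by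
  simp only [Complex.mk_eq_add_mul_I]
  fun_prop

lemma det3_identity {p q v w : E3} (hp : dot3 p p = 1) (hq : dot3 q q = 1)
    (hv : dot3 v v = 1) (hvw : dot3 v w = 0) :
    det3 p w q * (1 - dot3 p v - dot3 q v + dot3 p q)
        + (dot3 p w + dot3 q w) * det3 p v q
      = (1 + dot3 p q) * ((1 - dot3 q v) * det3 p v w - (1 - dot3 p v) * det3 q v w) := by
  have h1 : det3 p w q * dot3 v v
      = dot3 p v * det3 q v w + det3 p v q * dot3 v w - det3 p v w * dot3 q v := by
    simp only [det3_eq, dot3]; ring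
  have h2 : dot3 p v * det3 p w q
      = det3 q v w * dot3 p p + det3 p v q * dot3 p w - det3 p v w * dot3 p q := by
    simp only [det3_eq, dot3]; ring
  have h3 : dot3 q v * det3 p w q
      = det3 q v w * dot3 p q + det3 p v q * dot3 q w - det3 p v w * dot3 q q := by
    simp only [det3_eq, dot3]; ring
  rw [hv, hvw] at h1
  rw [hp] at h2
  rw [hq] at h3
  linear_combination (1 + dot3 p q) * h1 - h2 - h3

lemma gram_identity {p q v : E3} (hp : dot3 p p = 1) (hq : dot3 q q = 1) (hv : dot3 v v = 1) :
    (1 - dot3 p v - dot3 q v + dot3 p q) ^ 2 + det3 p v q ^ 2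
      = 2 * (1 + dot3 p q) * ((1 - dot3 p v) * (1 - dot3 q v)) := by
  have key : det3 p v q ^ 2 = dot3 p p * dot3 v v * dot3 q q
      + 2 * (dot3 p v * dot3 q v * dot3 p q) - dot3 p p * dot3 q v ^ 2
      - dot3 v v * dot3 p q ^ 2 - dot3 q q * dot3 p v ^ 2 := by
    simp only [det3_eq, dot3]; ring
  rw [key, hp, hq, hv]; ring

/-- The integrals of two potentials along a loop differ by a multiple of `4π`. -/
lemma exists_int_integral_spherePotential_sub {p q : E3} {v v' : ℝ → E3} {L : ℝ}
    (hp : ‖p‖ = 1) (hq : ‖q‖ = 1) (hpq : q ≠ -p)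
    (hv : ∀ t, HasDerivAt v (v' t) t) (hv' : Continuous v') (hv1 : ∀ t, ‖v t‖ = 1)
    (hvL : v L = v 0) (hvp : ∀ t, v t ≠ p) (hvq : ∀ t, v t ≠ q) :
    ∃ n : ℤ, (∫ t in (0:ℝ)..L, spherePotential p (v t) (v' t))
      - (∫ t in (0:ℝ)..L, spherePotential q (v t) (v' t)) = 4 * π * n := by
  have hvc : Continuous v := continuous_iff_continuousAt.2 fun t => (hv t).continuousAt
  have hP : ∀ t, 0 < 1 - dot3 p (v t) := fun t => one_sub_dot3_pos hp (hv1 t) (hvp t)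
  have hQ : ∀ t, 0 < 1 - dot3 q (v t) := fun t => one_sub_dot3_pos hq (hv1 t) (hvq t)
  have hC : 0 < 1 + dot3 p q := by
    have := one_sub_dot3_pos (p := -p) (by simpa using hp) hq hpq
    have h2 : dot3 (-p) q = - dot3 p q := by simp [dot3]; ring
    linarith
  have hdotc : ∀ r : E3, ∀ t, HasDerivAt (fun y => dot3 r (v y)) (dot3 r (v' t)) t := fun r t =>
    (hasDerivAt_dot3 (hasDerivAt_const t r) (hv t)).congr_deriv (by simp [dot3])
  have hdet : ∀ t, HasDerivAt (fun y => det3 p (v y) q) (det3 p (v' t) q) t := fun t =>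
    (hasDerivAt_det3_const (hv t) (hasDerivAt_const t q) p).congr_deriv (by simp [det3_eq])
  have horth : ∀ t, dot3 (v t) (v' t) = 0 := fun t => by
    have h1 := hasDerivAt_dot3 (hv t) (hv t)
    have h2 : (fun y => dot3 (v y) (v y)) = fun _ => (1:ℝ) :=
      funext fun y => dot3_self_of_norm_eq_one (hv1 y)
    rw [h2] at h1
    have h3 := h1.unique (hasDerivAt_const t (1:ℝ))
    simp only [dot3] at h3 ⊢
    linarith
  obtain ⟨n, hn⟩ := exists_int_integral_im_logDeriv
    (g := fun t => ⟨1 - dot3 p (v t) - dot3 q (v t) + dot3 p q, det3 p (v t) q⟩)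
    (g' := fun t => ⟨- dot3 p (v' t) - dot3 q (v' t), det3 p (v' t) q⟩) (L := L)
    (fun t => by
      refine hasDerivAt_complex_mk ?_ (hdet t)
      exact ((((hasDerivAt_const t (1:ℝ)).sub (hdotc p t)).sub (hdotc q t)).add
        (hasDerivAt_const t (dot3 p q))).congr_deriv (by ring))
    (continuous_complex_mk ((continuous_dot3 continuous_const hv').neg.sub
      (continuous_dot3 continuous_const hv')) (continuous_det3 continuous_const hv'
        continuous_const))
    (fun t h => by
      have h1 := congrArg Complex.re h
      have h2 := congrArg Complex.im h
      simp only [Complex.zero_re, Complex.zero_im] at h1 h2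
      have h3 := gram_identity (dot3_self_of_norm_eq_one hp) (dot3_self_of_norm_eq_one hq)
        (dot3_self_of_norm_eq_one (hv1 t))
      rw [h1, h2] at h3
      have := mul_pos hC (mul_pos (hP t) (hQ t))
      linarith)
    (by simp only [hvL])
  refine ⟨n, ?_⟩
  have hi : ∀ r : E3, (∀ t, 0 < 1 - dot3 r (v t)) →
      Continuous fun t => spherePotential r (v t) (v' t) := fun r hr =>
    (continuous_det3 continuous_const hvc hv').div
      (continuous_const.sub (continuous_dot3 continuous_const hvc)) fun t => (hr t).ne'
  rw [← intervalIntegral.integral_sub ((hi p hP).intervalIntegrable 0 L)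
    ((hi q hQ).intervalIntegrable 0 L), show 4 * π * (n:ℝ) = 2 * (2 * π * n) by ring, ← hn,
    ← intervalIntegral.integral_const_mul]
  refine intervalIntegral.integral_congr fun t _ => ?_
  have e1 := gram_identity (dot3_self_of_norm_eq_one hp) (dot3_self_of_norm_eq_one hq)
    (dot3_self_of_norm_eq_one (hv1 t))
  have e2 := det3_identity (p := p) (q := q) (dot3_self_of_norm_eq_one hp)
    (dot3_self_of_norm_eq_one hq) (dot3_self_of_norm_eq_one (hv1 t)) (horth t)
  simp only [im_div_eq, spherePotential]
  rw [e1]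
  have hP' := (hP t).ne'
  have hQ' := (hQ t).ne'
  have e3 : det3 p (v' t) q * (1 - dot3 p (v t) - dot3 q (v t) + dot3 p q) -
      (-dot3 p (v' t) - dot3 q (v' t)) * det3 p (v t) q = (1 + dot3 p q) *
      ((1 - dot3 q (v t)) * det3 p (v t) (v' t) - (1 - dot3 p (v t)) * det3 q (v t) (v' t)) := by
    rw [← e2]; ring
  rw [e3]
  have hC' := hC.ne'
  field_simp

lemma gram_expansion (x p T N : E3) :
    dot3 x p * (dot3 T T * dot3 N N - dot3 T N ^ 2)
      = dot3 x T * dot3 p T * dot3 N N + dot3 x N * dot3 p N * dot3 T T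
        - dot3 T N * (dot3 x T * dot3 p N + dot3 x N * dot3 p T) + det3 x T N * det3 p T N := by
  simp only [det3_eq, dot3]; ring

lemma frenet_identity {p T N M : E3} {κ : ℝ} (hp : dot3 p p = 1) (hT : dot3 T T = 1)
    (hN : dot3 N N = 1) (hTN : dot3 T N = 0) (hMT : dot3 M T = -κ) :
    dot3 p N ^ 2 + det3 p T N ^ 2 = 1 - dot3 p T ^ 2 ∧
    det3 p T M * dot3 p N - dot3 p M * det3 p T N
      = κ * dot3 p T * det3 p T N - dot3 M (cross3 T N) * (1 - dot3 p T ^ 2) := by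
  have h1 := gram_expansion p p T N
  have h2 := gram_expansion (cross3 M N) p T N
  have h3 : det3 p T M * dot3 p N - dot3 p M * det3 p T N
      = det3 T M N * dot3 p p - dot3 p T * dot3 (cross3 M N) p := by
    simp [det3_eq, dot3, cross3]; ring
  have h4 : dot3 (cross3 M N) N = 0 := by simp [dot3, cross3]; ring
  have h5 : dot3 (cross3 M N) T = - dot3 M (cross3 T N) := by simp [dot3, cross3]; ring
  have h6 : det3 T M N = - dot3 M (cross3 T N) := by simp [det3, dot3, cross3]; ring
  have h7 : det3 (cross3 M N) T N = dot3 M T * dot3 N N - dot3 M N * dot3 T N := by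
    simp [det3, dot3, cross3]; ring
  rw [h4, h5, h7, hT, hN, hTN, hMT] at h2
  rw [hp, hT, hN, hTN] at h1
  rw [hp, h6] at h3
  refine ⟨by linarith, ?_⟩
  rw [h3]
  linear_combination (-dot3 p T) * h2

/-- Along a closed framed curve, the mean of the potentials based at `p` and `-p` integrates to
the total torsion modulo `2π`. -/
lemma exists_int_integral_torsion {p : E3} {T N M : ℝ → E3} {κ : ℝ → ℝ} {L : ℝ}
    (hp : ‖p‖ = 1) (hT : ∀ t, HasDerivAt T (κ t • N t) t) (hN : ∀ t, HasDerivAt N (M t) t)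
    (hκ : Continuous κ) (hM : Continuous M) (hT1 : ∀ t, ‖T t‖ = 1) (hN1 : ∀ t, ‖N t‖ = 1)
    (hTN : ∀ t, dot3 (T t) (N t) = 0) (hTL : T L = T 0) (hNL : N L = N 0)
    (h1 : ∀ t, T t ≠ p) (h2 : ∀ t, T t ≠ -p) :
    ∃ n : ℤ, (∫ t in (0:ℝ)..L, spherePotential p (T t) (κ t • N t))
      + (∫ t in (0:ℝ)..L, spherePotential (-p) (T t) (κ t • N t))
      = 2 * (∫ t in (0:ℝ)..L, dot3 (M t) (cross3 (T t) (N t))) + 4 * π * n := by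
  have hTc : Continuous T := continuous_iff_continuousAt.2 fun t => (hT t).continuousAt
  have hNc : Continuous N := continuous_iff_continuousAt.2 fun t => (hN t).continuousAt
  have hP : ∀ t, 0 < 1 - dot3 p (T t) := fun t => one_sub_dot3_pos hp (hT1 t) (h1 t)
  have hQ : ∀ t, 0 < 1 - dot3 (-p) (T t) := fun t =>
    one_sub_dot3_pos (by simpa using hp) (hT1 t) (h2 t)
  have hneg : ∀ v, dot3 (-p) v = - dot3 p v := fun v => by simp [dot3]; ring
  have hnegd : ∀ v w, det3 (-p) v w = - det3 p v w := fun v w => by simp [det3_eq]; ring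
  have hD : ∀ t, 0 < 1 - dot3 p (T t) ^ 2 := fun t => by
    have h := mul_pos (hP t) (hQ t)
    rw [hneg] at h
    linarith
  have hMT : ∀ t, dot3 (M t) (T t) = - κ t := fun t => by
    have h1 := hasDerivAt_dot3 (hN t) (hT t)
    have h2 : (fun y => dot3 (N y) (T y)) = fun _ => (0:ℝ) :=
      funext fun y => by rw [← hTN y]; simp only [dot3]; ring
    rw [h2] at h1
    have h3 := h1.unique (hasDerivAt_const t (0:ℝ))
    rw [dot3_smul_right, dot3_self_of_norm_eq_one (hN1 t)] at h3
    linarith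
  have key := fun t => frenet_identity (dot3_self_of_norm_eq_one hp)
    (dot3_self_of_norm_eq_one (hT1 t)) (dot3_self_of_norm_eq_one (hN1 t)) (hTN t) (hMT t)
  obtain ⟨n, hn⟩ := exists_int_integral_im_logDeriv
    (g := fun t => ⟨dot3 p (N t), det3 p (T t) (N t)⟩)
    (g' := fun t => ⟨dot3 p (M t), det3 p (T t) (M t)⟩) (L := L)
    (fun t => by
      refine hasDerivAt_complex_mk ?_ ?_
      · exact (hasDerivAt_dot3 (hasDerivAt_const t p) (hN t)).congr_deriv (by simp [dot3])
      · exact (hasDerivAt_det3_const (hT t) (hN t) p).congr_deriv (by simp [det3_eq]; ring))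
    (continuous_complex_mk (continuous_dot3 continuous_const hM)
      (continuous_det3 continuous_const hTc hM))
    (fun t h => by
      have h1 := congrArg Complex.re h
      have h2 := congrArg Complex.im h
      simp only [Complex.zero_re, Complex.zero_im] at h1 h2
      have h3 := (key t).1
      rw [h1, h2] at h3
      have := hD t
      linarith)
    (by simp only [hTL, hNL])
  refine ⟨n, ?_⟩
  have hτ : Continuous fun t => dot3 (M t) (cross3 (T t) (N t)) := by
    have : (fun t => dot3 (M t) (cross3 (T t) (N t))) = fun t => det3 (M t) (T t) (N t) := rfl
    rw [this]
    exact continuous_det3 hM hTc hNc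
  have hi : ∀ r : E3, (∀ t, 0 < 1 - dot3 r (T t)) →
      Continuous fun t => spherePotential r (T t) (κ t • N t) := fun r hr =>
    (continuous_det3 continuous_const hTc (hκ.smul hNc)).div
      (continuous_const.sub (continuous_dot3 continuous_const hTc)) fun t => (hr t).ne'
  rw [show 4 * π * (n:ℝ) = 2 * (2 * π * n) by ring, ← hn, ← mul_add,
    ← intervalIntegral.integral_add ((hi p hP).intervalIntegrable 0 L)
    ((hi _ hQ).intervalIntegrable 0 L), ← intervalIntegral.integral_add
    (hτ.intervalIntegrable 0 L), ← intervalIntegral.integral_const_mul]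
  · refine intervalIntegral.integral_congr fun t _ => ?_
    simp only [im_div_eq, spherePotential]
    rw [(key t).1, (key t).2, hneg, hnegd]
    have e : det3 p (T t) (κ t • N t) = κ t * det3 p (T t) (N t) := by simp [det3_eq]; ring
    rw [e]
    have hP' := (hP t).ne'
    have hQ' := (hQ t).ne'
    have hD' := (hD t).ne'
    rw [hneg] at hQ'
    rw [show 1 - dot3 p (T t) ^ 2 = (1 - dot3 p (T t)) * (1 - -dot3 p (T t)) by ring] at *
    field_simp
    ring
  · refine Continuous.intervalIntegrable ?_ _ _
    simp only [im_div_eq]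
    refine Continuous.div ?_ ?_ fun t => ?_
    · exact ((continuous_det3 continuous_const hTc hM).mul (continuous_dot3 continuous_const hNc)).sub
        ((continuous_dot3 continuous_const hM).mul (continuous_det3 continuous_const hTc hNc))
    · exact ((continuous_dot3 continuous_const hNc).pow 2).add
        ((continuous_det3 continuous_const hTc hNc).pow 2)
    · rw [(key t).1]; exact (hD t).ne'

lemma hasFDerivAt_spherePotential {X : Type*} [NormedAddCommGroup X] [NormedSpace ℝ X]
    {u v : X → E3} {u' v' : X →L[ℝ] E3} {x : X} {p : E3}
    (hu : HasFDerivAt u u' x) (hv : HasFDerivAt v v' x) (h : 1 - dot3 p (u x) ≠ 0) :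
    ∃ D : X →L[ℝ] ℝ, HasFDerivAt (fun y => spherePotential p (u y) (v y)) D x ∧
      ∀ a, D a = ((det3 p (u' a) (v x) + det3 p (u x) (v' a)) * (1 - dot3 p (u x))
        + det3 p (u x) (v x) * dot3 p (u' a)) / (1 - dot3 p (u x)) ^ 2 := by
  obtain ⟨D₁, hD₁, h₁⟩ := hasFDerivAt_det3_const hu hv p
  obtain ⟨D₂, hD₂, h₂⟩ := hasFDerivAt_dot3_const hu p
  have hi := (hasDerivAt_inv h).comp_hasFDerivAt x (hD₂.const_sub 1)
  refine ⟨_, hD₁.mul hi, fun a => ?_⟩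
  simp [h₁, h₂]
  field_simp
  ring

lemma area_identity {p v a b c : E3} (hp : dot3 p p = 1) (hv : dot3 v v = 1)
    (ha : dot3 v a = 0) (hb : dot3 v b = 0) (h : 1 - dot3 p v ≠ 0) :
    -(((det3 p a b + det3 p v c) * (1 - dot3 p v) + det3 p v b * dot3 p a)
        / (1 - dot3 p v) ^ 2)
      + ((det3 p b a + det3 p v c) * (1 - dot3 p v) + det3 p v a * dot3 p b)
        / (1 - dot3 p v) ^ 2 = det3 v a b := by
  have h1 : det3 v a b * dot3 p v
      = det3 p a b * dot3 v v - det3 p v b * dot3 v a + det3 p v a * dot3 v b := by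
    simp only [det3_eq, dot3]; ring
  have h2 : det3 v a b * dot3 p p
      = det3 p a b * dot3 p v - det3 p v b * dot3 p a + det3 p v a * dot3 p b := by
    simp only [det3_eq, dot3]; ring
  have h3 : det3 p b a = - det3 p a b := by simp only [det3_eq]; ring
  rw [hv, ha, hb] at h1
  rw [hp] at h2
  rw [h3]
  field_simp
  linear_combination (-1) * h2 + (2 - dot3 p v) * h1

/-- The first partial derivative. -/
def partialFst (E : ℝ × ℝ → E3) (x : ℝ × ℝ) : E3 := fderiv ℝ E x (1, 0)

/-- The second partial derivative. -/
def partialSnd (E : ℝ × ℝ → E3) (x : ℝ × ℝ) : E3 := fderiv ℝ E x (0, 1)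

/-- The pullback of the area form of the unit sphere by `E`. -/
def areaDensity (E : ℝ × ℝ → E3) (x : ℝ × ℝ) : ℝ :=
  det3 (E x) (partialFst E x) (partialSnd E x)

lemma dot3_fderiv_eq_zero {X : Type*} [NormedAddCommGroup X] [NormedSpace ℝ X]
    {E : X → E3} {x : X} (hE : DifferentiableAt ℝ E x)
    (h1 : ∀ᶠ y in nhds x, ‖E y‖ = 1) (a : X) : dot3 (E x) (fderiv ℝ E x a) = 0 := by
  have hl : HasDerivAt (fun t : ℝ => x + t • a) a 0 := by
    simpa using ((hasDerivAt_id (0:ℝ)).smul_const a).const_add x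
  have hx : x = x + (0:ℝ) • a := by simp
  have hE' : HasFDerivAt E (fderiv ℝ E x) (x + (0:ℝ) • a) := hx ▸ hE.hasFDerivAt
  have hc := hE'.comp_hasDerivAt (0:ℝ) hl
  have hd := hasDerivAt_dot3 hc hc
  have ht : Filter.Tendsto (fun t : ℝ => x + t • a) (nhds 0) (nhds x) := by
    have := hl.continuousAt.tendsto
    rwa [← hx] at this
  have he : (fun t : ℝ => dot3 ((E ∘ fun t : ℝ => x + t • a) t) ((E ∘ fun t : ℝ => x + t • a) t))
      =ᶠ[nhds 0] fun _ => (1:ℝ) :=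
    (ht.eventually h1).mono fun t h => dot3_self_of_norm_eq_one h
  have h3 := hd.unique ((hasDerivAt_const (0:ℝ) (1:ℝ)).congr_of_eventuallyEq he)
  simp only [Function.comp, ← hx, dot3] at h3 ⊢
  linarith

/-- The exterior derivative of the pulled back potential is the pulled back area form. -/
lemma exists_hasFDerivAt_spherePotential_partial {E : ℝ × ℝ → E3} {x : ℝ × ℝ} {p : E3}
    (hp : ‖p‖ = 1) (hE : ContDiffAt ℝ 2 E x) (h1 : ∀ᶠ y in nhds x, ‖E y‖ = 1) (hx : E x ≠ p) :
    ∃ D₁ D₂ : ℝ × ℝ →L[ℝ] ℝ,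
      HasFDerivAt (fun y => - spherePotential p (E y) (partialSnd E y)) D₁ x ∧
      HasFDerivAt (fun y => spherePotential p (E y) (partialFst E y)) D₂ x ∧
      D₁ (1, 0) + D₂ (0, 1) = areaDensity E x := by
  have hEx : ‖E x‖ = 1 := h1.self_of_nhds
  have h0 : 1 - dot3 p (E x) ≠ 0 := (one_sub_dot3_pos hp hEx hx).ne'
  have hd : DifferentiableAt ℝ E x := hE.differentiableAt (by norm_num)
  have hd2 : DifferentiableAt ℝ (fderiv ℝ E) x :=
    (hE.fderiv_right (m := 1) (by norm_num)).differentiableAt (by norm_num)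
  have happ : ∀ a, HasFDerivAt (fun y => fderiv ℝ E y a)
      ((ContinuousLinearMap.apply ℝ E3 a).comp (fderiv ℝ (fderiv ℝ E) x)) x := fun a =>
    (ContinuousLinearMap.apply ℝ E3 a).hasFDerivAt.comp x hd2.hasFDerivAt
  have hsym : IsSymmSndFDerivAt ℝ E x := hE.isSymmSndFDerivAt (by simp)
  obtain ⟨D₁, hD₁, e₁⟩ := hasFDerivAt_spherePotential hd.hasFDerivAt (happ (0, 1)) h0
  obtain ⟨D₂, hD₂, e₂⟩ := hasFDerivAt_spherePotential hd.hasFDerivAt (happ (1, 0)) h0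
  refine ⟨-D₁, D₂, hD₁.neg, hD₂, ?_⟩
  rw [neg_apply, e₁, e₂]
  simp only [ContinuousLinearMap.comp_apply, ContinuousLinearMap.apply_apply]
  rw [hsym.eq (0, 1) (1, 0)]
  exact area_identity (dot3_self_of_norm_eq_one hp) (dot3_self_of_norm_eq_one hEx)
    (dot3_fderiv_eq_zero hd h1 _) (dot3_fderiv_eq_zero hd h1 _) h0

lemma continuousAt_partial {E : ℝ × ℝ → E3} {x : ℝ × ℝ} (hE : ContDiffAt ℝ 2 E x) :
    ContinuousAt (partialFst E) x ∧ ContinuousAt (partialSnd E) x := by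
  have h := (hE.fderiv_right (m := 1) (by norm_num)).continuousAt
  exact ⟨h.clm_apply continuousAt_const, h.clm_apply continuousAt_const⟩

lemma continuousAt_areaDensity {E : ℝ × ℝ → E3} {x : ℝ × ℝ} (hE : ContDiffAt ℝ 2 E x) :
    ContinuousAt (areaDensity E) x :=
  continuousAt_det3 hE.continuousAt (continuousAt_partial hE).1 (continuousAt_partial hE).2

lemma partial_add_period {E : ℝ × ℝ → E3} {L : ℝ} (hper : ∀ s u, E (s + L, u) = E (s, u))
    (s u : ℝ) : partialFst E (s + L, u) = partialFst E (s, u) ∧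
      partialSnd E (s + L, u) = partialSnd E (s, u) := by
  have h : (fun y : ℝ × ℝ => E (y + (L, 0))) = E := by
    ext1 ⟨a, b⟩
    simp [hper]
  have h2 := fderiv_comp_add_right (𝕜 := ℝ) (f := E) (x := (s, u)) (L, (0:ℝ))
  rw [h] at h2
  simp only [Prod.mk_add_mk, add_zero] at h2
  simp [partialFst, partialSnd, h2]

/-- Stokes' theorem on a strip avoiding the pole of the potential. -/
lemma integral_areaDensity_strip {E : ℝ × ℝ → E3} {L u₁ u₂ : ℝ} {p : E3} (hp : ‖p‖ = 1)
    (hper : ∀ s u, E (s + L, u) = E (s, u))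
    (hE : ∀ s, ∀ u ∈ Set.uIcc u₁ u₂, ContDiffAt ℝ 2 E (s, u))
    (h1 : ∀ s, ∀ u ∈ Set.uIcc u₁ u₂, ∀ᶠ y in nhds (s, u), ‖E y‖ = 1)
    (hx : ∀ s, ∀ u ∈ Set.uIcc u₁ u₂, E (s, u) ≠ p) :
    (∫ s in (0:ℝ)..L, ∫ u in u₁..u₂, areaDensity E (s, u))
      = (∫ s in (0:ℝ)..L, spherePotential p (E (s, u₂)) (partialFst E (s, u₂)))
        - ∫ s in (0:ℝ)..L, spherePotential p (E (s, u₁)) (partialFst E (s, u₁)) := by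
  set f : ℝ × ℝ → ℝ := fun y => - spherePotential p (E y) (partialSnd E y) with hf
  set g : ℝ × ℝ → ℝ := fun y => spherePotential p (E y) (partialFst E y) with hg
  have key : ∀ s, ∀ u ∈ Set.uIcc u₁ u₂, HasFDerivAt f (fderiv ℝ f (s, u)) (s, u) ∧
      HasFDerivAt g (fderiv ℝ g (s, u)) (s, u) ∧
      fderiv ℝ f (s, u) (1, 0) + fderiv ℝ g (s, u) (0, 1) = areaDensity E (s, u) := by
    intro s u hu
    obtain ⟨D₁, D₂, hD₁, hD₂, h⟩ :=
      exists_hasFDerivAt_spherePotential_partial hp (hE s u hu) (h1 s u hu) (hx s u hu)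
    rw [hD₁.fderiv, hD₂.fderiv]
    exact ⟨hD₁, hD₂, h⟩
  have hsub : ∀ x ∈ Set.Ioo (min 0 L) (max 0 L) ×ˢ Set.Ioo (min u₁ u₂) (max u₁ u₂),
      x.2 ∈ Set.uIcc u₁ u₂ := fun x hx => Set.Ioo_subset_Icc_self hx.2
  have G := MeasureTheory.integral2_divergence_prod_of_hasFDerivAt f g (fderiv ℝ f) (fderiv ℝ g)
    0 u₁ L u₂ (fun x hx => (key x.1 x.2 hx.2).1.continuousAt.continuousWithinAt)
    (fun x hx => (key x.1 x.2 hx.2).2.1.continuousAt.continuousWithinAt)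
    (fun x hx => (key x.1 x.2 (hsub x hx)).1) (fun x hx => (key x.1 x.2 (hsub x hx)).2.1)
    (by
      refine (MeasureTheory.integrableOn_congr_fun (g := areaDensity E)
        (fun x hx => (key x.1 x.2 hx.2).2.2)
        (measurableSet_uIcc.prod measurableSet_uIcc)).2 ?_
      exact ContinuousOn.integrableOn_compact (isCompact_uIcc.prod isCompact_uIcc) fun x hx =>
        (continuousAt_areaDensity (hE x.1 x.2 hx.2)).continuousWithinAt)
  have hfL : ∀ u, f (L, u) = f (0, u) := fun u => by
    have e1 := hper 0 u
    have e2 := (partial_add_period hper 0 u).2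
    rw [zero_add] at e1 e2
    simp only [hf, e1, e2]
  have e : (∫ s in (0:ℝ)..L, ∫ u in u₁..u₂, areaDensity E (s, u)) =
      ∫ s in (0:ℝ)..L, ∫ u in u₁..u₂,
        fderiv ℝ f (s, u) (1, 0) + fderiv ℝ g (s, u) (0, 1) :=
    intervalIntegral.integral_congr fun s _ =>
      intervalIntegral.integral_congr fun u hu => (key s u hu).2.2.symm
  rw [e, G]
  simp only [hfL]
  ring

lemma hasDerivAt_slice {E : ℝ × ℝ → E3} {s u : ℝ} (hE : DifferentiableAt ℝ E (s, u)) :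
    HasDerivAt (fun t => E (t, u)) (partialFst E (s, u)) s :=
  hE.hasFDerivAt.comp_hasDerivAt s ((hasDerivAt_id s).prodMk (hasDerivAt_const s u))

/-- The boundary integrals of potentials on the two ends of a cylinder mapped to the sphere
differ by the area swept out, modulo `4π`. -/
lemma exists_int_boundary_sub {E : ℝ × ℝ → E3} {L : ℝ} {e : E3} (hL : 0 < L)
    (hper : ∀ s u, E (s + L, u) = E (s, u))
    (hE : ∀ s, ∀ u ∈ Set.Icc 0 L, ContDiffAt ℝ 2 E (s, u))
    (h1 : ∀ s, ∀ u ∈ Set.Icc 0 L, ∀ᶠ y in nhds (s, u), ‖E y‖ = 1)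
    (havoid : ∀ u ∈ Set.Icc 0 L, ∃ p : E3, (‖p‖ = 1 ∧ 0 < dot3 p e) ∧ ∀ s, E (s, u) ≠ p)
    {p₀ p₁ : E3} (hp₀ : ‖p₀‖ = 1 ∧ 0 < dot3 p₀ e) (hp₁ : ‖p₁‖ = 1 ∧ 0 < dot3 p₁ e)
    (h₀ : ∀ s, E (s, 0) ≠ p₀) (h₁ : ∀ s, E (s, L) ≠ p₁) :
    ∃ n : ℤ, (∫ s in (0:ℝ)..L, spherePotential p₁ (E (s, L)) (partialFst E (s, L)))
      - (∫ s in (0:ℝ)..L, spherePotential p₀ (E (s, 0)) (partialFst E (s, 0)))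
      = (∫ s in (0:ℝ)..L, ∫ u in (0:ℝ)..L, areaDensity E (s, u)) + 4 * π * n := by
  set A : E3 → ℝ → ℝ := fun p u =>
    ∫ s in (0:ℝ)..L, spherePotential p (E (s, u)) (partialFst E (s, u)) with hA
  set w : ℝ → ℝ → ℝ := fun s u => areaDensity E (s, max 0 (min L u)) with hw
  have hclamp : ∀ u, max 0 (min L u) ∈ Set.Icc 0 L := fun u =>
    ⟨le_max_left _ _, max_le hL.le (min_le_left _ _)⟩
  have hwc : Continuous (Function.uncurry w) := by
    rw [continuous_iff_continuousAt]
    rintro ⟨s, u⟩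
    exact ContinuousAt.comp (f := fun y : ℝ × ℝ => (y.1, max 0 (min L y.2)))
      (g := areaDensity E)
      (continuousAt_areaDensity (hE s _ (hclamp u))) (by fun_prop)
  have hwi : ∀ a b, Continuous fun s => ∫ u in a..b, w s u := fun a b =>
    intervalIntegral.continuous_parametric_intervalIntegral_of_continuous' hwc a b
  have hwE : ∀ s, ∀ u ∈ Set.Icc 0 L, w s u = areaDensity E (s, u) := fun s u hu => by
    simp only [hw]
    rw [min_eq_right hu.2, max_eq_right hu.1]
  set J : ℝ → ℝ := fun u => ∫ s in (0:ℝ)..L, ∫ v in (0:ℝ)..u, w s v with hJ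
  have hJsub : ∀ a b, J b - J a = ∫ s in (0:ℝ)..L, ∫ v in a..b, w s v := fun a b => by
    simp only [hJ]
    rw [← intervalIntegral.integral_sub ((hwi _ _).intervalIntegrable _ _)
      ((hwi _ _).intervalIntegrable _ _)]
    refine intervalIntegral.integral_congr fun s _ => ?_
    have hc : Continuous (w s) := hwc.comp (by fun_prop : Continuous fun u => (s, u))
    exact intervalIntegral.integral_interval_sub_left (hc.intervalIntegrable _ _)
      (hc.intervalIntegrable _ _)
  have hindep : ∀ u ∈ Set.Icc 0 L, ∀ p q : E3, (‖p‖ = 1 ∧ 0 < dot3 p e) →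
      (‖q‖ = 1 ∧ 0 < dot3 q e) → (∀ s, E (s, u) ≠ p) → (∀ s, E (s, u) ≠ q) →
      ∃ n : ℤ, A p u - A q u = 4 * π * n := by
    intro u hu p q hp hq hEp hEq
    refine exists_int_integral_spherePotential_sub (v := fun s => E (s, u)) hp.1 hq.1 ?_
      (fun s => hasDerivAt_slice ((hE s u hu).differentiableAt (by norm_num))) ?_
      (fun s => (h1 s u hu).self_of_nhds) ?_ hEp hEq
    · rintro rfl
      have h2 : dot3 (-p) e = - dot3 p e := by simp [dot3]; ring
      linarith [hp.2, hq.2]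
    · rw [continuous_iff_continuousAt]
      intro s
      exact ContinuousAt.comp (f := fun s : ℝ => (s, u)) (g := partialFst E)
        (continuousAt_partial (hE s u hu)).1 (by fun_prop)
    · simpa using hper 0 u
  have hlocal : ∀ u₀ : Set.Icc 0 L, ∃ p : E3, (‖p‖ = 1 ∧ 0 < dot3 p e) ∧
      (∀ s, E (s, u₀) ≠ p) ∧ ∀ᶠ u : Set.Icc 0 L in nhds u₀, (∀ s, E (s, u) ≠ p) ∧
        A p u - A p u₀ = J u - J u₀ := by
    rintro ⟨u₀, hu₀⟩
    obtain ⟨p, hp, hEp⟩ := havoid u₀ hu₀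
    refine ⟨p, hp, hEp, ?_⟩
    have hev : ∀ᶠ u in nhds u₀, ∀ s ∈ Set.Icc 0 L, E (s, u) ≠ p := by
      refine isCompact_Icc.eventually_forall_of_forall_eventually fun s _ => ?_
      have hc : ContinuousAt (fun z : ℝ × ℝ => E (z.2, z.1)) (u₀, s) :=
        ContinuousAt.comp (f := fun z : ℝ × ℝ => (z.2, z.1)) (g := E)
          (hE s u₀ hu₀).continuousAt (by fun_prop)
      exact hc.eventually_ne (hEp s)
    obtain ⟨ε, hε, hball⟩ := Metric.eventually_nhds_iff_ball.1 hev
    have hball' : ∀ u ∈ Metric.ball u₀ ε, ∀ s, E (s, u) ≠ p := by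
      intro u hu s
      have hperu : Function.Periodic (fun s => E (s, u)) L := fun s => hper s u
      obtain ⟨s', hs', hss⟩ := hperu.exists_mem_Ico₀ hL s
      rw [show E (s, u) = E (s', u) from hss]
      exact hball u hu s' (Set.Ico_subset_Icc_self hs')
    have hnear : ∀ᶠ u : Set.Icc 0 L in nhds ⟨u₀, hu₀⟩, (u : ℝ) ∈ Metric.ball u₀ ε :=
      continuous_subtype_val.continuousAt.eventually (Metric.ball_mem_nhds u₀ hε)
    filter_upwards [hnear] with u hu
    refine ⟨hball' u hu, ?_⟩
    have hsub : Set.uIcc u₀ (u : ℝ) ⊆ Set.Icc 0 L := Set.uIcc_subset_Icc hu₀ u.2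
    have hsub' : Set.uIcc u₀ (u : ℝ) ⊆ Metric.ball u₀ ε := by
      rw [← segment_eq_uIcc]
      exact (convex_ball u₀ ε).segment_subset (Metric.mem_ball_self hε) hu
    rw [hJsub, hA]
    dsimp only
    rw [← integral_areaDensity_strip hp.1 hper (fun s v hv => hE s v (hsub hv))
      (fun s v hv => h1 s v (hsub hv)) (fun s v hv => hball' v (hsub' hv) s)]
    exact intervalIntegral.integral_congr fun s _ =>
      intervalIntegral.integral_congr fun v hv => (hwE s v (hsub hv)).symm
  let Q : Set.Icc 0 L → Prop := fun u => ∀ p : E3, (‖p‖ = 1 ∧ 0 < dot3 p e) →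
    (∀ s, E (s, u) ≠ p) → ∃ n : ℤ, A p u - A p₀ 0 = J u + 4 * π * n
  have hQ : IsLocallyConstant Q := by
    rw [IsLocallyConstant.iff_eventually_eq]
    intro u₀
    obtain ⟨p, hp, hEp, hev⟩ := hlocal u₀
    filter_upwards [hev] with u ⟨hEu, hAu⟩
    refine propext ⟨fun h q hq hEq => ?_, fun h q hq hEq => ?_⟩
    · obtain ⟨n, hn⟩ := h p hp hEu
      obtain ⟨m, hm⟩ := hindep u₀ u₀.2 q p hq hp hEq hEp
      refine ⟨n + m, ?_⟩
      push_cast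
      linarith
    · obtain ⟨n, hn⟩ := h p hp hEp
      obtain ⟨m, hm⟩ := hindep u u.2 q p hq hp hEq hEu
      refine ⟨n + m, ?_⟩
      push_cast
      linarith
  have hzero : (0:ℝ) ∈ Set.Icc 0 L := ⟨le_rfl, hL.le⟩
  have hLmem : L ∈ Set.Icc 0 L := ⟨hL.le, le_rfl⟩
  have : PreconnectedSpace (Set.Icc 0 L) := Subtype.preconnectedSpace isPreconnected_Icc
  have hQ0 : Q ⟨0, hzero⟩ := fun p hp hEp => by
    obtain ⟨n, hn⟩ := hindep 0 hzero p p₀ hp hp₀ hEp h₀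
    exact ⟨n, by simpa [hJ] using hn⟩
  have hQL : Q ⟨L, hLmem⟩ := by
    rwa [hQ.apply_eq_of_preconnectedSpace ⟨L, hLmem⟩ ⟨0, hzero⟩]
  obtain ⟨n, hn⟩ := hQL p₁ hp₁ h₁
  refine ⟨n, hn.trans ?_⟩
  congr 1
  refine intervalIntegral.integral_congr fun s _ => intervalIntegral.integral_congr fun u hu => ?_
  rw [Set.uIcc_of_le hL.le] at hu
  exact hwE s u hu

lemma hasFDerivAt_integral_of_contDiff {X Y : Type} [NormedAddCommGroup X] [NormedSpace ℝ X]
    [ProperSpace X] [NormedAddCommGroup Y] [NormedSpace ℝ Y]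
    {F : X × ℝ → Y} (hF : ContDiff ℝ 1 F) (a b : ℝ) (x : X) :
    HasFDerivAt (fun x => ∫ r in a..b, F (x, r))
      (∫ r in a..b, (fderiv ℝ F (x, r)).comp (ContinuousLinearMap.inl ℝ X ℝ)) x := by
  have hc : Continuous fun z : X × ℝ =>
      (fderiv ℝ F z).comp (ContinuousLinearMap.inl ℝ X ℝ) :=
    (hF.continuous_fderiv (by norm_num)).clm_comp continuous_const
  obtain ⟨C, hC⟩ := ((isCompact_closedBall x 1).prod
    (isCompact_uIcc (a := a) (b := b))).exists_bound_of_continuousOn hc.continuousOn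
  refine intervalIntegral.hasFDerivAt_integral_of_dominated_of_fderiv_le
    (F := fun x r => F (x, r)) (bound := fun _ => C)
    (F' := fun x r => (fderiv ℝ F (x, r)).comp (ContinuousLinearMap.inl ℝ X ℝ))
    (Metric.closedBall_mem_nhds x one_pos) ?_ ?_ ?_ ?_ ?_ ?_
  · exact Filter.Eventually.of_forall fun y =>
      (hF.continuous.comp (by fun_prop : Continuous fun r : ℝ => (y, r))).aestronglyMeasurable
  · exact (hF.continuous.comp
      (by fun_prop : Continuous fun r : ℝ => (x, r))).intervalIntegrable _ _
  · exact (hc.comp (by fun_prop : Continuous fun r : ℝ => (x, r))).aestronglyMeasurable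
  · exact Filter.Eventually.of_forall fun r hr y hy => hC (y, r) ⟨hy, Set.uIoc_subset_uIcc hr⟩
  · exact intervalIntegrable_const
  · refine Filter.Eventually.of_forall fun r _ y _ => ?_
    exact ((hF.differentiable (by norm_num)) (y, r)).hasFDerivAt.comp y
      (hasFDerivAt_prodMk_left y r)

/-- Integrals depending smoothly on a parameter. -/
lemma contDiff_integral_of_contDiff {X : Type} [NormedAddCommGroup X] [NormedSpace ℝ X]
    [ProperSpace X] (a b : ℝ) (n : ℕ) :
    ∀ {Y : Type} [NormedAddCommGroup Y] [NormedSpace ℝ Y] {F : X × ℝ → Y},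
      ContDiff ℝ (⊤ : ℕ∞) F → ContDiff ℝ n (fun x => ∫ r in a..b, F (x, r)) := by
  induction n with
  | zero =>
    intro Y _ _ F hF
    refine contDiff_zero.2 (continuous_iff_continuousAt.2 fun x => ?_)
    exact (hasFDerivAt_integral_of_contDiff
      (hF.of_le (by exact_mod_cast le_top)) a b x).continuousAt
  | succ n ih =>
    intro Y _ _ F hF
    push_cast
    refine contDiff_succ_iff_hasFDerivAt.2 ⟨_, ?_, fun x =>
      hasFDerivAt_integral_of_contDiff (hF.of_le (by exact_mod_cast le_top)) a b x⟩
    exact ih ((hF.fderiv_right (m := (⊤ : ℕ∞)) (by simp)).clm_comp contDiff_const)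

/-- The difference quotient `(f (s + u) - f s) / u`, as an average of the derivative. -/
def meanDeriv (f : ℝ → E3) (x : ℝ × ℝ) : E3 := ∫ r in (0:ℝ)..1, deriv f (x.1 + x.2 * r)

lemma contDiff_meanDeriv {f : ℝ → E3} (hf : ContDiff ℝ (⊤ : ℕ∞) f) :
    ContDiff ℝ 2 (meanDeriv f) := by
  have hf' : ContDiff ℝ (⊤ : ℕ∞) (deriv f) := by
    simpa using hf.iterate_deriv 1
  exact contDiff_integral_of_contDiff 0 1 2
    (F := fun z : (ℝ × ℝ) × ℝ => deriv f (z.1.1 + z.1.2 * z.2))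
    (hf'.comp (by fun_prop))

lemma smul_meanDeriv {f : ℝ → E3} (hf : ContDiff ℝ (⊤ : ℕ∞) f) (s u : ℝ) :
    u • meanDeriv f (s, u) = f (s + u) - f s := by
  have hf' : Continuous (deriv f) := hf.continuous_deriv (by simp)
  have hd : Differentiable ℝ f := hf.differentiable (by simp)
  simp only [meanDeriv, intervalIntegral.smul_integral_comp_add_mul]
  simp only [mul_zero, add_zero, mul_one]
  exact intervalIntegral.integral_deriv_eq_sub (fun x _ => hd x) (hf'.intervalIntegrable _ _)

lemma meanDeriv_zero (f : ℝ → E3) (s : ℝ) : meanDeriv f (s, 0) = deriv f s := by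
  simp [meanDeriv]

/-- A smooth rescaling of the chord `f (s + u) - f s`, which does not degenerate at the ends
of a period. -/
def chord (f : ℝ → E3) (L : ℝ) (x : ℝ × ℝ) : E3 :=
  meanDeriv f x - meanDeriv f (x.1, x.2 - L)

/-- The unit secant map. -/
def secant (f : ℝ → E3) (L : ℝ) (x : ℝ × ℝ) : E3 := ‖chord f L x‖⁻¹ • chord f L x

section Chord

variable {f : ℝ → E3} {L : ℝ}

lemma contDiff_chord (hf : ContDiff ℝ (⊤ : ℕ∞) f) : ContDiff ℝ 2 (chord f L) :=
  (contDiff_meanDeriv hf).sub ((contDiff_meanDeriv hf).comp (by fun_prop))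

lemma deriv_periodic (hper : Function.Periodic f L) : Function.Periodic (deriv f) L := fun s => by
  rw [← deriv_comp_add_const, show (fun x => f (x + L)) = f from funext hper]

lemma chord_add_period (hper : Function.Periodic f L) (s u : ℝ) :
    chord f L (s + L, u) = chord f L (s, u) := by
  have h : ∀ v, meanDeriv f (s + L, v) = meanDeriv f (s, v) := fun v => by
    simp only [meanDeriv]
    refine intervalIntegral.integral_congr fun r _ => ?_
    rw [show s + L + v * r = s + v * r + L by ring, deriv_periodic hper]
  simp only [chord, h]

lemma chord_zero (hL : 0 < L) (hf : ContDiff ℝ (⊤ : ℕ∞) f) (hper : Function.Periodic f L) (s : ℝ) :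
    chord f L (s, 0) = deriv f s := by
  have h := smul_meanDeriv hf s (0 - L)
  rw [show s + (0 - L) = s - L by ring, hper.sub_eq, sub_self, smul_eq_zero] at h
  rw [chord, meanDeriv_zero, h.resolve_left (by linarith), sub_zero]

lemma chord_period (hL : 0 < L) (hf : ContDiff ℝ (⊤ : ℕ∞) f) (hper : Function.Periodic f L)
    (s : ℝ) : chord f L (s, L) = - deriv f s := by
  have h := smul_meanDeriv hf s L
  rw [hper, sub_self, smul_eq_zero] at h
  rw [chord, sub_self, meanDeriv_zero, h.resolve_left hL.ne', zero_sub]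

lemma chord_of_mem_Ioo (hf : ContDiff ℝ (⊤ : ℕ∞) f) (hper : Function.Periodic f L) (s : ℝ)
    {u : ℝ} (hu : u ∈ Set.Ioo 0 L) :
    chord f L (s, u) = (u⁻¹ + (L - u)⁻¹) • (f (s + u) - f s) := by
  have h1 := smul_meanDeriv hf s u
  have h2 := smul_meanDeriv hf s (u - L)
  rw [show s + (u - L) = s + u - L by ring, hper.sub_eq] at h2
  have hu0 : u ≠ 0 := hu.1.ne'
  have hu1 : u - L ≠ 0 := by linarith [hu.2]
  rw [← eq_inv_smul_iff₀ hu0] at h1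
  rw [← eq_inv_smul_iff₀ hu1] at h2
  rw [chord, h1, h2, ← sub_smul, show (L - u)⁻¹ = - (u - L)⁻¹ by rw [← neg_sub, inv_neg],
    sub_eq_add_neg u⁻¹]

lemma chord_coeff_pos {u : ℝ} (hu : u ∈ Set.Ioo 0 L) : 0 < u⁻¹ + (L - u)⁻¹ :=
  add_pos (inv_pos.2 hu.1) (inv_pos.2 (by linarith [hu.2]))

lemma add_ne_of_injOn (hL : 0 < L) (hper : Function.Periodic f L)
    (hinj : Set.InjOn f (Set.Ico 0 L)) (s : ℝ) {u : ℝ} (hu : u ∈ Set.Ioo 0 L) :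
    f (s + u) ≠ f s := by
  intro h
  have hm : ∀ x, toIcoMod hL 0 x ∈ Set.Ico 0 L := fun x => by
    simpa using toIcoMod_mem_Ico hL 0 x
  have hval : ∀ x, f (toIcoMod hL 0 x) = f x := fun x => by
    rw [toIcoMod, hper.sub_zsmul_eq]
  have h2 := hinj (hm (s + u)) (hm s) (by rw [hval, hval, h])
  rw [toIcoMod, toIcoMod] at h2
  simp only [zsmul_eq_mul] at h2
  have h3 : u = ((toIcoDiv hL 0 (s + u) - toIcoDiv hL 0 s : ℤ) : ℝ) * L := by
    push_cast; linarith
  set k := toIcoDiv hL 0 (s + u) - toIcoDiv hL 0 s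
  have h4 : (0:ℝ) < k := by
    by_contra h5
    nlinarith [hu.1]
  have h6 : (k:ℝ) < 1 := by
    by_contra h5
    nlinarith [hu.2]
  have h7 : 0 < k := by exact_mod_cast h4
  have h8 : k < 1 := by exact_mod_cast h6
  omega

lemma chord_ne_zero (hL : 0 < L) (hf : ContDiff ℝ (⊤ : ℕ∞) f) (hper : Function.Periodic f L)
    (harc : ∀ s, ‖deriv f s‖ = 1) (hinj : Set.InjOn f (Set.Ico 0 L)) (s : ℝ) {u : ℝ}
    (hu : u ∈ Set.Icc 0 L) : chord f L (s, u) ≠ 0 := by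
  have hne : deriv f s ≠ 0 := norm_ne_zero_iff.1 (by rw [harc]; exact one_ne_zero)
  rcases hu.1.eq_or_lt with rfl | h0
  · rwa [chord_zero hL hf hper]
  rcases hu.2.eq_or_lt with rfl | h1
  · rw [chord_period hL hf hper]
    exact neg_ne_zero.2 hne
  · rw [chord_of_mem_Ioo hf hper s ⟨h0, h1⟩]
    exact smul_ne_zero (chord_coeff_pos ⟨h0, h1⟩).ne'
      (sub_ne_zero.2 (add_ne_of_injOn hL hper hinj s ⟨h0, h1⟩))

lemma contDiffAt_secant (hf : ContDiff ℝ (⊤ : ℕ∞) f) {x : ℝ × ℝ} (hx : chord f L x ≠ 0) :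
    ContDiffAt ℝ 2 (secant f L) x := by
  have h := (contDiff_chord (L := L) hf).contDiffAt (x := x)
  exact ((h.norm ℝ hx).inv (norm_ne_zero_iff.2 hx)).smul h

lemma eventually_norm_secant (hf : ContDiff ℝ (⊤ : ℕ∞) f) {x : ℝ × ℝ} (hx : chord f L x ≠ 0) :
    ∀ᶠ y in nhds x, ‖secant f L y‖ = 1 := by
  filter_upwards [(contDiff_chord (L := L) hf).continuous.continuousAt.eventually_ne hx] with y hy
  rw [secant, norm_smul, norm_inv, norm_norm, inv_mul_cancel₀ (norm_ne_zero_iff.2 hy)]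

/-- The secant map misses some pair of antipodal directions on each slice. -/
lemma exists_secant_ne (hf : ContDiff ℝ (⊤ : ℕ∞) f) (u : ℝ) :
    ∃ p : E3, (‖p‖ = 1 ∧ 0 < dot3 p (EuclideanSpace.single 0 1)) ∧
      ∀ s, secant f L (s, u) ≠ p ∧ secant f L (s, u) ≠ -p := by
  have hΦ : ContDiff ℝ 1 fun z : ℝ × ℝ => z.1 • chord f L (z.2, u) :=
    contDiff_fst.smul (((contDiff_chord hf).of_le (by norm_num)).comp (by fun_prop))
  have hdense := hΦ.dense_compl_range_of_finrank_lt_finrank (by simp)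
  have hopen : IsOpen {x : E3 | 0 < x 0} := isOpen_lt continuous_const (by fun_prop)
  obtain ⟨x, hx0, hx⟩ := hdense.inter_open_nonempty _ hopen
    ⟨EuclideanSpace.single 0 1, by simp⟩
  simp only [Set.mem_ofPred_eq] at hx0
  have hxne : x ≠ 0 := by
    rintro rfl
    simp at hx0
  have hn : 0 < ‖x‖ := norm_pos_iff.2 hxne
  have hrange : ∀ (s c : ℝ), secant f L (s, u) = c • x → c ≠ 0 → False := by
    intro s c h hc
    refine hx ⟨(c⁻¹ * ‖chord f L (s, u)‖⁻¹, s), ?_⟩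
    change (c⁻¹ * ‖chord f L (s, u)‖⁻¹) • chord f L (s, u) = x
    rw [mul_smul, show ‖chord f L (s, u)‖⁻¹ • chord f L (s, u) = c • x from h,
      inv_smul_smul₀ hc]
  refine ⟨‖x‖⁻¹ • x, ⟨?_, ?_⟩, fun s => ⟨fun h => ?_, fun h => ?_⟩⟩
  · rw [norm_smul, norm_inv, norm_norm, inv_mul_cancel₀ hn.ne']
  · simp [dot3]
    positivity
  · exact hrange s _ h (inv_pos.2 hn).ne'
  · exact hrange s (-‖x‖⁻¹) (by rw [h, neg_smul]) (neg_ne_zero.2 (inv_pos.2 hn).ne')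

end Chord

lemma secant_of_mem_Ioo {f : ℝ → E3} {L : ℝ} (hf : ContDiff ℝ (⊤ : ℕ∞) f)
    (hper : Function.Periodic f L) (s : ℝ) {u : ℝ} (hu : u ∈ Set.Ioo 0 L) :
    secant f L (s, u) = ‖f (s + u) - f s‖⁻¹ • (f (s + u) - f s) := by
  have hc := chord_coeff_pos hu
  rw [secant, chord_of_mem_Ioo hf hper s hu, norm_smul, Real.norm_of_nonneg hc.le, smul_smul,
    mul_inv, mul_right_comm, inv_mul_cancel₀ hc.ne', one_mul]

/-- The area density of the secant map is the Gauss integrand. -/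
lemma areaDensity_secant {f : ℝ → E3} {L : ℝ} (hL : 0 < L) (hf : ContDiff ℝ (⊤ : ℕ∞) f)
    (hper : Function.Periodic f L) (hinj : Set.InjOn f (Set.Ico 0 L)) (s : ℝ) {u : ℝ}
    (hu : u ∈ Set.Ioo 0 L) :
    areaDensity (secant f L) (s, u)
      = det3 (deriv f s) (deriv f (s + u)) (f s - f (s + u)) / ‖f s - f (s + u)‖ ^ 3 := by
  have hd : ∀ t, HasFDerivAt f (ContinuousLinearMap.toSpanSingleton ℝ (deriv f t)) t := fun t =>
    (hf.differentiable (by simp) t).hasDerivAt.hasFDerivAt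
  have hF : HasFDerivAt (fun y : ℝ × ℝ => f (y.1 + y.2) - f y.1) _ (s, u) :=
    ((hd (s + u)).comp (s, u) ((hasFDerivAt_fst (𝕜 := ℝ)).add hasFDerivAt_snd)).sub
      ((hd s).comp (s, u) (hasFDerivAt_fst (𝕜 := ℝ)))
  have hne : f (s + u) - f s ≠ 0 := sub_ne_zero.2 (add_ne_of_injOn hL hper hinj s hu)
  obtain ⟨D, hlam⟩ : DifferentiableAt ℝ (fun y : ℝ × ℝ => ‖f (y.1 + y.2) - f y.1‖⁻¹) (s, u) :=
    (hF.differentiableAt.norm ℝ hne).inv (norm_ne_zero_iff.2 hne)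
  have hE : (secant f L) =ᶠ[nhds (s, u)]
      fun y : ℝ × ℝ => ‖f (y.1 + y.2) - f y.1‖⁻¹ • (f (y.1 + y.2) - f y.1) := by
    have hev : ∀ᶠ y : ℝ × ℝ in nhds (s, u), y.2 ∈ Set.Ioo 0 L :=
      (continuous_snd.continuousAt (x := (s, u))).eventually (isOpen_Ioo.mem_nhds hu)
    filter_upwards [hev] with y hy
    exact secant_of_mem_Ioo hf hper y.1 hy
  have hE' : HasFDerivAt (secant f L) _ (s, u) :=
    HasFDerivAt.congr_of_eventuallyEq (HasFDerivAt.fun_smul hlam hF) hE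
  rw [areaDensity, partialFst, partialSnd, hE'.fderiv, secant_of_mem_Ioo hf hper s hu,
    norm_sub_rev (f s)]
  have hn : ‖f (s + u) - f s‖ ≠ 0 := norm_ne_zero_iff.2 hne
  simp [det3_eq]
  generalize ‖f (s + u) - f s‖ = ν at *
  field_simp
  ring

lemma writhe_eq_integral_areaDensity {f : ℝ → E3} {L : ℝ} (hL : 0 < L)
    (hf : ContDiff ℝ (⊤ : ℕ∞) f) (hper : Function.Periodic f L)
    (hinj : Set.InjOn f (Set.Ico 0 L)) :
    4 * π * writhe f L = ∫ s in (0:ℝ)..L, ∫ u in (0:ℝ)..L, areaDensity (secant f L) (s, u) := by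
  have hπ := pi_ne_zero
  rw [writhe, ← mul_assoc, mul_one_div_cancel (by positivity), one_mul]
  refine intervalIntegral.integral_congr fun s _ => ?_
  set W : ℝ → ℝ := fun t => det3 (deriv f s) (deriv f t) (f s - f t) / ‖f s - f t‖ ^ 3 with hW
  have hWper : Function.Periodic W L := fun t => by
    simp only [hW, hper t, deriv_periodic hper t]
  have e1 := hWper.intervalIntegral_add_eq 0 s
  rw [zero_add] at e1
  rw [e1]
  have e2 := intervalIntegral.integral_comp_add_left (a := 0) (b := L) W s
  rw [add_zero] at e2
  rw [← e2]
  exact intervalIntegral.integral_congr_Ioo_of_le hL.le fun u hu =>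
    (areaDensity_secant hL hf hper hinj s hu).symm

/-- Călugăreanu–Pohl. For a knot with nowhere vanishing curvature,
`4π·Wr(f) = −2 ∫₀^L τ ds + 4πk` for some integer `k`; i.e. `Wr(f) + Tω(f) ∈ ℤ`. -/
theorem writhe_plus_totalTorsion_integer
    (f : ℝ → E3) (L : ℝ) (hL : 0 < L)
    (hf : ContDiff ℝ (⊤ : ℕ∞) f) (hper : Function.Periodic f L)
    (harc : ∀ s, ‖deriv f s‖ = 1) (hinj : Set.InjOn f (Set.Ico 0 L))
    (hκ : ∀ s, ‖deriv (deriv f) s‖ > 0) :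
    ∃ k : ℤ, 4 * π * writhe f L
      = -2 * (∫ s in (0:ℝ)..L, torsionArc f s) + 4 * π * (k : ℝ) := by
  have hne : ∀ s, ∀ u ∈ Set.Icc 0 L, chord f L (s, u) ≠ 0 := fun s u hu =>
    chord_ne_zero hL hf hper harc hinj s hu
  have hzero : (0:ℝ) ∈ Set.Icc 0 L := ⟨le_rfl, hL.le⟩
  have hLmem : L ∈ Set.Icc 0 L := ⟨hL.le, le_rfl⟩
  have hE := fun s u hu => contDiffAt_secant hf (hne s u hu)
  have hf' : ContDiff ℝ (⊤ : ℕ∞) (deriv f) := by simpa using hf.iterate_deriv 1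
  have hf'' : ContDiff ℝ (⊤ : ℕ∞) (deriv (deriv f)) := by simpa using hf'.iterate_deriv 1
  have hκ0 : ∀ s, deriv (deriv f) s ≠ 0 := fun s => norm_pos_iff.1 (hκ s)
  have hN : ContDiff ℝ (⊤ : ℕ∞) (e2 f) :=
    ((hf''.norm ℝ hκ0).inv fun s => (hκ s).ne').smul hf''
  have hT : ∀ s, HasDerivAt (deriv f) (‖deriv (deriv f) s‖ • e2 f s) s := fun s => by
    rw [e2, smul_inv_smul₀ (hκ s).ne']
    exact (hf'.differentiable (by simp) s).hasDerivAt
  have hsec0 : ∀ s, secant f L (s, 0) = deriv f s := fun s => by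
    rw [secant, chord_zero hL hf hper, harc]; simp
  have hsecL : ∀ s, secant f L (s, L) = - deriv f s := fun s => by
    rw [secant, chord_period hL hf hper, norm_neg, harc]; simp
  have hpar0 : ∀ s, partialFst (secant f L) (s, 0) = ‖deriv (deriv f) s‖ • e2 f s := fun s => by
    have h := hasDerivAt_slice ((hE s 0 hzero).differentiableAt (by norm_num))
    simp only [hsec0] at h
    exact h.unique (hT s)
  have hparL : ∀ s, partialFst (secant f L) (s, L) = -(‖deriv (deriv f) s‖ • e2 f s) := fun s => by
    have h := hasDerivAt_slice ((hE s L hLmem).differentiableAt (by norm_num))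
    simp only [hsecL] at h
    exact h.unique (hT s).neg
  obtain ⟨p, hp, hpne⟩ := exists_secant_ne (L := L) hf 0
  have hTp : ∀ s, deriv f s ≠ p := fun s => by rw [← hsec0]; exact (hpne s).1
  have hTp' : ∀ s, deriv f s ≠ -p := fun s => by rw [← hsec0]; exact (hpne s).2
  obtain ⟨n, hn⟩ := exists_int_boundary_sub hL
    (fun s u => by rw [secant, chord_add_period hper, ← secant]) hE
    (fun s u hu => eventually_norm_secant hf (hne s u hu))
    (fun u _ => by
      obtain ⟨q, hq, hqne⟩ := exists_secant_ne (L := L) hf u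
      exact ⟨q, hq, fun s => (hqne s).1⟩) hp hp
    (fun s => (hpne s).1)
    (fun s h => hTp' s (by rw [hsecL] at h; rw [← h, neg_neg]))
  have horth : ∀ s, dot3 (deriv f s) (e2 f s) = 0 := fun s => by
    have h := dot3_fderiv_eq_zero (hf'.differentiable (by simp) s)
      (Filter.Eventually.of_forall harc) 1
    rw [fderiv_apply_one_eq_deriv] at h
    rw [e2, dot3_smul_right, h, mul_zero]
  have hT' := deriv_periodic hper
  have hT'' := deriv_periodic hT'
  obtain ⟨m, hm⟩ := exists_int_integral_torsion (L := L) hp.1 hT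
    (fun s => (hN.differentiable (by simp) s).hasDerivAt) hf''.continuous.norm
    (hN.continuous_deriv (by simp)) harc
    (fun s => by rw [e2, norm_smul, norm_inv, norm_norm, inv_mul_cancel₀ (hκ s).ne']) horth
    (by simpa using hT' 0) (by simp only [e2]; rw [← zero_add L, hT'' 0]) hTp hTp'
  rw [← writhe_eq_integral_areaDensity hL hf hper hinj] at hn
  simp only [hsec0, hsecL, hpar0, hparL] at hn
  have hneg : ∀ v w, spherePotential p (-v) (-w) = - spherePotential (-p) v w := fun v w => by
    have h1 : det3 p (-v) (-w) = - det3 (-p) v w := by simp [det3_eq]; ring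
    have h2 : dot3 p (-v) = dot3 (-p) v := by simp [dot3]
    rw [spherePotential, h1, h2, neg_div, spherePotential]
  simp only [hneg, intervalIntegral.integral_neg] at hn
  refine ⟨-(m + n), ?_⟩
  have hτ : (∫ s in (0:ℝ)..L, torsionArc f s)
      = ∫ s in (0:ℝ)..L, dot3 (deriv (e2 f) s) (cross3 (deriv f s) (e2 f s)) := rfl
  rw [hτ]
  push_cast
  linarith
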